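/- Let n ∈ ℕ, let c_0, …, c_{2^n} ∈ ℝ, let f : [0,∞) → ℝ be integrable, let (Tf)(x) = Σ_{k=0}^{2^n} c_k·f(2x ⊖ k) and m(y) = (1/2)·Σ_{k=0}^{2^n} c_k·w_k(y). Then for every N ∈ ℕ and every y ∈ [0,∞), the N-th iterate of T satisfies (𝔉(T^N f))(y) = (𝔉f)(2^{−N} y)·∏_{j=1}^{N} m(2^{−j} y). -/

import Mathlib

open MeasureTheory Finset

/-- The `j`-th binary digit of `x` after the binary point. -/
noncomputable def binDigit (j : ℕ) (x : ℝ) : ℕ := (⌊(2:ℝ)^j * x⌋).toNat % 2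

/-- The Walsh function `w_k(x) = (-1)^{∑ k_i d_{i+1}(x)}`. -/
noncomputable def walsh (k : ℕ) (x : ℝ) : ℝ :=
  (-1 : ℝ) ^ (∑ i ∈ Finset.range (k+1), (k / 2^i % 2) * binDigit (i+1) x)

/-- The generalized Walsh kernel `ψ(x,y) = w_{⌊y⌋}(x) · w_{⌊x⌋}(y)`. -/
noncomputable def walshKernel (x y : ℝ) : ℝ := walsh (⌊y⌋).toNat x * walsh (⌊x⌋).toNat y

/-- The Walsh–Fourier transform `(𝔉f)(y) = ∫_{[0,∞)} ψ(x,y) f(x) dx`. -/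
noncomputable def walshFourier (f : ℝ → ℝ) (y : ℝ) : ℝ :=
  ∫ x in Set.Ici (0:ℝ), walshKernel x y * f x

/-- The dyadic translate `x ⊕ j = (⌊x⌋ XOR j) + (x - ⌊x⌋)`. -/
noncomputable def dyadicAdd (x : ℝ) (j : ℕ) : ℝ := ((⌊x⌋.toNat ^^^ j : ℕ) : ℝ) + (x - ⌊x⌋)

theorem walsh_eq_prod {k M : ℕ} (h : k < M) (x : ℝ) :
    walsh k x = ∏ i ∈ Finset.range M, (-1 : ℝ) ^ ((k / 2 ^ i % 2) * binDigit (i + 1) x) := by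
  rw [walsh, ← Finset.prod_pow_eq_pow_sum]
  refine Finset.prod_subset (Finset.range_mono h) fun i _ hi => ?_
  have hki : k < i := by simpa using hi
  simp [Nat.div_eq_of_lt (hki.trans i.lt_two_pow_self)]

theorem walsh_mul_self (k : ℕ) (x : ℝ) : walsh k x * walsh k x = 1 := by
  rw [walsh, ← pow_add, Even.neg_one_pow ⟨_, rfl⟩]

theorem norm_walsh (k : ℕ) (x : ℝ) : ‖walsh k x‖ = 1 := by
  simp [walsh]

theorem walsh_xor (a b : ℕ) (x : ℝ) : walsh (a ^^^ b) x = walsh a x * walsh b x := by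
  have ha : a < a + b + (a ^^^ b) + 1 := by omega
  have hb : b < a + b + (a ^^^ b) + 1 := by omega
  have hab : a ^^^ b < a + b + (a ^^^ b) + 1 := by omega
  rw [walsh_eq_prod ha, walsh_eq_prod hb, walsh_eq_prod hab, ← Finset.prod_mul_distrib]
  refine Finset.prod_congr rfl fun i _ => ?_
  rw [← pow_add, ← add_mul, Nat.xor_div_two_pow, pow_mul, pow_mul]
  congr 1
  rcases Nat.mod_two_eq_zero_or_one (a / 2 ^ i) with h | h <;>
    rcases Nat.mod_two_eq_zero_or_one (b / 2 ^ i) with h' | h' <;>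
    simp [Nat.xor_mod_two_eq, Nat.add_mod, h, h']

theorem binDigit_succ_half (i : ℕ) (x : ℝ) : binDigit (i + 1) (x / 2) = binDigit i x := by
  rw [binDigit, binDigit, pow_succ, mul_assoc, mul_div_cancel₀ x two_ne_zero]

theorem walsh_half (k : ℕ) (x : ℝ) :
    walsh k (x / 2) = (-1 : ℝ) ^ ((k % 2) * (⌊x⌋.toNat % 2)) * walsh (k / 2) x := by
  have hk : k < (k + 1) + 1 := by omega
  have hk' : k / 2 < k + 1 := by omega
  rw [walsh_eq_prod hk, walsh_eq_prod hk', Finset.prod_range_succ', mul_comm]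
  congr 1
  · rw [binDigit_succ_half, binDigit, pow_zero, pow_zero, Nat.div_one, one_mul]
  · refine Finset.prod_congr rfl fun i _ => ?_
    rw [binDigit_succ_half, pow_succ', Nat.div_div_eq_div_mul]

theorem toNat_floor_half (x : ℝ) : ⌊x / 2⌋.toNat = ⌊x⌋.toNat / 2 := by
  rw [Int.floor_toNat, Int.floor_toNat]
  exact_mod_cast Nat.floor_div_natCast x 2

theorem walshKernel_half_left (x y : ℝ) : walshKernel (x / 2) y = walshKernel x (y / 2) := by
  simp only [walshKernel, walsh_half, toNat_floor_half]
  rw [mul_comm (⌊y⌋.toNat % 2)]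
  ring

theorem dyadicAdd_eq_add (x : ℝ) (k : ℕ) :
    dyadicAdd x k = x + (((⌊x⌋.toNat ^^^ k : ℕ) : ℤ) - ⌊x⌋ : ℤ) := by
  simp only [dyadicAdd]
  push_cast
  ring

theorem floor_dyadicAdd (x : ℝ) (k : ℕ) : ⌊dyadicAdd x k⌋ = (⌊x⌋.toNat ^^^ k : ℕ) := by
  rw [dyadicAdd_eq_add, Int.floor_add_intCast]
  ring

theorem binDigit_succ_add_int {x : ℝ} (hx : 0 ≤ x) (z : ℤ) (hz : 0 ≤ x + z) (i : ℕ) :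
    binDigit (i + 1) (x + z) = binDigit (i + 1) x := by
  have h₁ : 0 ≤ ⌊(2 : ℝ) ^ (i + 1) * x⌋ := Int.floor_nonneg.2 (by positivity)
  have h₂ : 0 ≤ ⌊(2 : ℝ) ^ (i + 1) * (x + z)⌋ := Int.floor_nonneg.2 (by positivity)
  have h₃ : ⌊(2 : ℝ) ^ (i + 1) * (x + z)⌋ = ⌊(2 : ℝ) ^ (i + 1) * x⌋ + 2 * (2 ^ i * z) := by
    rw [← Int.floor_add_intCast]
    congr 1
    push_cast
    ring
  unfold binDigit
  omega

theorem walsh_dyadicAdd (l k : ℕ) {x : ℝ} (hx : 0 ≤ x) : walsh l (dyadicAdd x k) = walsh l x := by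
  have h : 0 ≤ dyadicAdd x k := by
    have := Int.floor_le x
    unfold dyadicAdd
    have : (0 : ℝ) ≤ x - ⌊x⌋ := by linarith
    positivity
  rw [dyadicAdd_eq_add] at h ⊢
  simp only [walsh, binDigit_succ_add_int hx _ h]

theorem walshKernel_dyadicAdd {x : ℝ} (hx : 0 ≤ x) (y : ℝ) (k : ℕ) :
    walshKernel (dyadicAdd x k) y = walshKernel x y * walsh k y := by
  rw [walshKernel, walshKernel, walsh_dyadicAdd _ _ hx, floor_dyadicAdd, Int.toNat_natCast,
    walsh_xor, mul_assoc]

theorem measurable_toNat_floor : Measurable fun x : ℝ => ⌊x⌋.toNat := by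
  simpa only [Int.floor_toNat] using Nat.measurable_floor (R := ℝ)

theorem measurable_walsh (k : ℕ) : Measurable (walsh k) := by
  have h (j : ℕ) : Measurable (binDigit j) :=
    (measurable_from_nat (f := (· % 2))).comp
      (measurable_toNat_floor.comp (measurable_const_mul ((2 : ℝ) ^ j)))
  refine (measurable_from_nat (f := fun i => (-1 : ℝ) ^ i)).comp ?_
  exact Finset.measurable_fun_sum _ fun i _ => (h (i + 1)).const_mul _

theorem measurable_walshKernel (y : ℝ) : Measurable fun x => walshKernel x y :=
  (measurable_walsh _).mul
    ((measurable_from_nat (f := fun i => walsh i y)).comp measurable_toNat_floor)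

theorem norm_walshKernel (x y : ℝ) : ‖walshKernel x y‖ = 1 := by
  rw [walshKernel, norm_mul, norm_walsh, norm_walsh, one_mul]

theorem MeasureTheory.IntegrableOn.walshKernel_mul {g : ℝ → ℝ} {s : Set ℝ}
    (hg : IntegrableOn g s) (y : ℝ) : IntegrableOn (fun x => walshKernel x y * g x) s :=
  hg.bdd_mul (c := 1) (measurable_walshKernel y).aestronglyMeasurable
    (Filter.Eventually.of_forall fun x => (norm_walshKernel x y).le)

theorem measurable_dyadicAdd (k : ℕ) : Measurable fun x => dyadicAdd x k := by
  refine Measurable.add ?_ (measurable_id.sub ?_)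
  · exact (measurable_from_nat (f := fun i => ((i ^^^ k : ℕ) : ℝ))).comp measurable_toNat_floor
  · exact (measurable_from_top (f := fun z : ℤ => (z : ℝ))).comp Int.measurable_floor

theorem restrict_Ici_zero_eq_sum :
    volume.restrict (Set.Ici (0 : ℝ)) =
      Measure.sum fun j : ℕ => volume.restrict (Set.Ico (j : ℝ) (j + 1)) := by
  rw [← Measure.restrict_iUnion]
  · congr 1
    ext x
    simp only [Set.mem_Ici, Set.mem_iUnion, Set.mem_Ico]
    refine ⟨fun hx => ⟨⌊x⌋₊, Nat.floor_le hx, Nat.lt_floor_add_one x⟩, ?_⟩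
    rintro ⟨j, hj, -⟩
    exact (Nat.cast_nonneg j).trans hj
  · intro i j hij
    refine Set.disjoint_left.2 fun x hx hx' => hij ?_
    have hi : ⌊x⌋ = (i : ℤ) := Int.floor_eq_iff.2 (by simpa using hx)
    have hj : ⌊x⌋ = (j : ℤ) := Int.floor_eq_iff.2 (by simpa using hx')
    omega
  · exact fun _ => measurableSet_Ico

theorem map_dyadicAdd_restrict_Ico (j k : ℕ) :
    (volume.restrict (Set.Ico (j : ℝ) (j + 1))).map (fun x => dyadicAdd x k) =
      volume.restrict (Set.Ico ((j ^^^ k : ℕ) : ℝ) ((j ^^^ k : ℕ) + 1)) := by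
  set a : ℝ := ((j ^^^ k : ℕ) : ℝ) - j with ha
  have h : (fun x => dyadicAdd x k) =ᵐ[volume.restrict (Set.Ico (j : ℝ) (j + 1))] (· + a) := by
    filter_upwards [ae_restrict_mem measurableSet_Ico] with x hx
    have hj : ⌊x⌋ = (j : ℤ) := Int.floor_eq_iff.2 (by simpa using hx)
    simp only [dyadicAdd, hj, Int.toNat_natCast, Int.cast_natCast, ha]
    ring
  rw [Measure.map_congr h]
  have hp := (measurePreserving_add_right (volume : Measure ℝ) a).restrict_preimage
    (s := Set.Ico ((j ^^^ k : ℕ) : ℝ) ((j ^^^ k : ℕ) + 1)) measurableSet_Ico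
  have hs : (· + a) ⁻¹' Set.Ico ((j ^^^ k : ℕ) : ℝ) ((j ^^^ k : ℕ) + 1) =
      Set.Ico (j : ℝ) (j + 1) := by
    rw [Set.preimage_add_const_Ico, ha]
    congr 1 <;> ring
  rw [hs] at hp
  exact hp.map_eq

theorem measurePreserving_dyadicAdd (k : ℕ) :
    MeasurePreserving (fun x => dyadicAdd x k) (volume.restrict (Set.Ici (0 : ℝ)))
      (volume.restrict (Set.Ici (0 : ℝ))) := by
  refine ⟨measurable_dyadicAdd k, ?_⟩
  have hinv : Function.Involutive fun j : ℕ => j ^^^ k := fun j => by simp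
  rw [restrict_Ici_zero_eq_sum, Measure.map_sum (measurable_dyadicAdd k).aemeasurable]
  simp only [map_dyadicAdd_restrict_Ico]
  exact Measure.sum_comp_equiv hinv.toPerm
    (m := fun j : ℕ => volume.restrict (Set.Ico (j : ℝ) (j + 1)))

theorem integrableOn_comp_dyadicAdd {g : ℝ → ℝ} (hg : IntegrableOn g (Set.Ici 0)) (k : ℕ) :
    IntegrableOn (fun x => g (dyadicAdd x k)) (Set.Ici 0) :=
  (measurePreserving_dyadicAdd k).integrable_comp_of_integrable hg

theorem integrableOn_comp_dyadicAdd_two_mul {g : ℝ → ℝ} (hg : IntegrableOn g (Set.Ici 0))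
    (k : ℕ) : IntegrableOn (fun x => g (dyadicAdd (2 * x) k)) (Set.Ici 0) := by
  have h := integrableOn_comp_dyadicAdd hg k
  rw [integrableOn_Ici_iff_integrableOn_Ioi] at h ⊢
  have := (integrableOn_Ioi_comp_mul_left_iff (fun x => g (dyadicAdd x k)) 0 two_pos).2
  simp only [mul_zero] at this
  exact this h

theorem walshFourier_comp_two_mul (g : ℝ → ℝ) (y : ℝ) :
    walshFourier (fun x => g (2 * x)) y = 1 / 2 * walshFourier g (y / 2) := by
  have h := integral_comp_mul_left_Ioi (fun x => walshKernel x (y / 2) * g x) 0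
    (two_pos (α := ℝ))
  simp only [mul_zero, smul_eq_mul] at h
  rw [walshFourier, walshFourier, integral_Ici_eq_integral_Ioi, integral_Ici_eq_integral_Ioi,
    one_div, ← h]
  refine integral_congr_ae (Filter.Eventually.of_forall fun x => ?_)
  simp only [← walshKernel_half_left]
  rw [mul_div_cancel_left₀ x two_ne_zero]

theorem walshFourier_comp_dyadicAdd {g : ℝ → ℝ} (hg : IntegrableOn g (Set.Ici 0)) (k : ℕ)
    (y : ℝ) : walshFourier (fun x => g (dyadicAdd x k)) y = walsh k y * walshFourier g y := by
  have hp := measurePreserving_dyadicAdd k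
  have h : ∫ x in Set.Ici (0 : ℝ), walshKernel (dyadicAdd x k) y * g (dyadicAdd x k) =
      walshFourier g y := by
    rw [walshFourier]
    have hm := (hg.walshKernel_mul y).aestronglyMeasurable
    rw [← hp.map_eq] at hm
    have := integral_map hp.aemeasurable hm
    rw [hp.map_eq] at this
    exact this.symm
  rw [← h, walshFourier, ← integral_const_mul]
  refine setIntegral_congr_fun measurableSet_Ici fun x hx => ?_
  simp only [walshKernel_dyadicAdd hx]
  linear_combination (-(walshKernel x y * g (dyadicAdd x k))) * walsh_mul_self k y

theorem walshFourier_sum_dyadicAdd {g : ℝ → ℝ} (hg : IntegrableOn g (Set.Ici 0)) (s : Finset ℕ)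
    (c : ℕ → ℝ) (y : ℝ) :
    walshFourier (fun x => ∑ k ∈ s, c k * g (dyadicAdd (2 * x) k)) y =
      walshFourier g (y / 2) * (1 / 2 * ∑ k ∈ s, c k * walsh k (y / 2)) := by
  have h (k : ℕ) : walshFourier (fun x => g (dyadicAdd (2 * x) k)) y =
      1 / 2 * (walsh k (y / 2) * walshFourier g (y / 2)) := by
    rw [← walshFourier_comp_dyadicAdd hg, ← walshFourier_comp_two_mul]
  simp only [Finset.mul_sum]
  rw [walshFourier]
  simp only [Finset.mul_sum, mul_left_comm (walshKernel _ _)]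
  rw [integral_finsetSum]
  · refine Finset.sum_congr rfl fun k _ => ?_
    rw [integral_const_mul, ← walshFourier, h]
    ring
  · exact fun k _ =>
      ((integrableOn_comp_dyadicAdd_two_mul hg k).walshKernel_mul y).const_mul (c k)

/-- For integrable `f` and the transition operator `T`, the `N`-th iterate satisfies
`(𝔉(T^N f))(y) = (𝔉f)(2^{-N} y) · ∏_{j=1}^{N} m(2^{-j} y)`. -/
theorem walshFourier_transition_iterate (n : ℕ) (c : ℕ → ℝ) (f : ℝ → ℝ)
    (hf : IntegrableOn f (Set.Ici 0) volume)
    (T : (ℝ → ℝ) → ℝ → ℝ)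
    (hT : ∀ g : ℝ → ℝ, ∀ x : ℝ,
      T g x = ∑ k ∈ Finset.range (2^n + 1), c k * g (dyadicAdd (2*x) k))
    (m : ℝ → ℝ)
    (hm : ∀ y : ℝ, m y = (1/2) * ∑ k ∈ Finset.range (2^n + 1), c k * walsh k y) :
    ∀ N : ℕ, ∀ y : ℝ, 0 ≤ y →
      walshFourier (T^[N] f) y
        = walshFourier f ((2:ℝ)^(-(N:ℤ)) * y) *
            ∏ j ∈ Finset.Icc 1 N, m ((2:ℝ)^(-(j:ℤ)) * y) := by
  intro N
  induction N generalizing f with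
  | zero => simp
  | succ N ih =>
    intro y hy
    have hTf : T f = fun x => ∑ k ∈ Finset.range (2 ^ n + 1), c k * f (dyadicAdd (2 * x) k) :=
      funext (hT f)
    have hint : IntegrableOn (T f) (Set.Ici 0) := by
      rw [hTf]
      exact integrable_finsetSum _ fun k _ =>
        (integrableOn_comp_dyadicAdd_two_mul hf k).const_mul (c k)
    have hhalf : (2 : ℝ) ^ (-(N : ℤ)) * y / 2 = (2 : ℝ) ^ (-((N + 1 : ℕ) : ℤ)) * y := by
      rw [Nat.cast_succ, neg_add, zpow_add₀ two_ne_zero, zpow_neg_one]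
      ring
    rw [Function.iterate_succ_apply, ih (T f) hint y hy, hTf, walshFourier_sum_dyadicAdd hf,
      ← hm, hhalf, Finset.prod_Icc_succ_top (by omega)]
    ring
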